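/- Let m be a positive integer, let r_1 ≤ r_2 ≤ ⋯ ≤ r_m be real numbers, and let θ be a positive integer. Suppose r_j^t (for 1 ≤ j ≤ m, 1 ≤ t ≤ θ) are real numbers such that ∑_{j=k}^m ∑_{t=1}^θ r_j^t ≥ θ·∑_{j=k}^m r_j for every k with 2 ≤ k ≤ m, and ∑_{j=1}^m ∑_{t=1}^θ r_j^t = θ·∑_{j=1}^m r_j. Then ∑_{j=1}^m ∑_{t=1}^θ (r_j^t)² ≥ θ·∑_{j=1}^m r_j², and equality holds if and only if r_j^t = r_j for all t = 1,…,θ and j = 1,…,m. -/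

import Mathlib

open Finset

/-- Abel summation inequality: if `r` is nondecreasing on `[n, m]` and the proper tail sums of `d`
are nonnegative, then weighting `d` by `r` gives at least `r n` times the sum of `d`. -/
theorem mul_sum_Icc_le_sum_mul_of_tail_nonneg {n m : ℕ} (hnm : n ≤ m) {r d : ℕ → ℝ}
    (hr : ∀ j, n ≤ j → j < m → r j ≤ r (j + 1))
    (hd : ∀ k, n < k → k ≤ m → 0 ≤ ∑ j ∈ Icc k m, d j) :
    r n * ∑ j ∈ Icc n m, d j ≤ ∑ j ∈ Icc n m, r j * d j := by
  induction hnm using Nat.decreasingInduction with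
  | self => simp
  | of_succ k hk ih =>
    have h := ih (fun j hj => hr j (by omega)) (fun l hl => hd l (by omega))
    have hmul := mul_le_mul_of_nonneg_right (hr k le_rfl hk) (hd (k + 1) k.lt_succ_self hk)
    rw [← Finset.add_sum_Ioc_eq_sum_Icc hk.le, ← Finset.add_sum_Ioc_eq_sum_Icc hk.le,
      ← Finset.Icc_add_one_left_eq_Ioc]
    linarith

/-- Lemma 4.4 (first part): for a nondecreasing sequence `r 1 ≤ ⋯ ≤ r m` of reals and
reals `a j t` (`1 ≤ j ≤ m`, `1 ≤ t ≤ θ`) whose tail sums dominate `θ` times the tail sums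
of `r` and whose total sum equals `θ` times the total sum of `r`, the sum of squares of
the `a j t` is at least `θ` times the sum of squares of the `r j`, with equality iff
`a j t = r j` for all `j, t`. -/
theorem lemma_4_4_part1 (m θ : ℕ) (hm : 0 < m) (hθ : 0 < θ)
    (r : ℕ → ℝ) (a : ℕ → ℕ → ℝ)
    (hmono : ∀ j k, 1 ≤ j → j ≤ k → k ≤ m → r j ≤ r k)
    (htail : ∀ k, 2 ≤ k → k ≤ m →
      ∑ j ∈ Icc k m, ∑ t ∈ Icc 1 θ, a j t ≥ (θ : ℝ) * ∑ j ∈ Icc k m, r j)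
    (htotal : ∑ j ∈ Icc 1 m, ∑ t ∈ Icc 1 θ, a j t = (θ : ℝ) * ∑ j ∈ Icc 1 m, r j) :
    (∑ j ∈ Icc 1 m, ∑ t ∈ Icc 1 θ, (a j t) ^ 2 ≥ (θ : ℝ) * ∑ j ∈ Icc 1 m, (r j) ^ 2) ∧
    ((∑ j ∈ Icc 1 m, ∑ t ∈ Icc 1 θ, (a j t) ^ 2 = (θ : ℝ) * ∑ j ∈ Icc 1 m, (r j) ^ 2) ↔
      ∀ j ∈ Icc 1 m, ∀ t ∈ Icc 1 θ, a j t = r j) := by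
  have hsub : ∀ k, ∑ j ∈ Icc k m, (∑ t ∈ Icc 1 θ, a j t - θ * r j) =
      ∑ j ∈ Icc k m, ∑ t ∈ Icc 1 θ, a j t - θ * ∑ j ∈ Icc k m, r j := fun k => by
    rw [sum_sub_distrib, mul_sum]
  have habel : 0 ≤ ∑ j ∈ Icc 1 m, r j * (∑ t ∈ Icc 1 θ, a j t - θ * r j) := by
    have h := mul_sum_Icc_le_sum_mul_of_tail_nonneg (r := r)
      (d := fun j => ∑ t ∈ Icc 1 θ, a j t - θ * r j) (Nat.succ_le_of_lt hm)
      (fun j hj hjm => hmono j (j + 1) hj j.le_succ hjm)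
      (fun k hk hkm => by rw [hsub]; exact sub_nonneg.2 (htail k hk hkm))
    rwa [hsub, htotal, sub_self, mul_zero] at h
  have hexpand : ∑ j ∈ Icc 1 m, ∑ t ∈ Icc 1 θ, (a j t) ^ 2 =
      θ * ∑ j ∈ Icc 1 m, (r j) ^ 2 + ∑ j ∈ Icc 1 m, ∑ t ∈ Icc 1 θ, (a j t - r j) ^ 2 +
        2 * ∑ j ∈ Icc 1 m, r j * (∑ t ∈ Icc 1 θ, a j t - θ * r j) := by
    rw [mul_sum, mul_sum, ← sum_add_distrib, ← sum_add_distrib]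
    refine sum_congr rfl fun j _ => ?_
    simp only [sub_sq, sum_add_distrib, sum_sub_distrib, ← sum_mul, ← mul_sum, sum_const,
      Nat.card_Icc, nsmul_eq_mul, Nat.add_sub_cancel]
    ring
  have hinner : ∀ j ∈ Icc 1 m, 0 ≤ ∑ t ∈ Icc 1 θ, (a j t - r j) ^ 2 :=
    fun j _ => sum_nonneg fun t _ => sq_nonneg _
  have hsq := sum_nonneg hinner
  refine ⟨by linarith, fun heq j hj t ht => ?_, fun h => ?_⟩
  · have hzero : ∑ j ∈ Icc 1 m, ∑ t ∈ Icc 1 θ, (a j t - r j) ^ 2 = 0 := by linarith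
    have hj0 := (sum_eq_zero_iff_of_nonneg hinner).1 hzero j hj
    have ht0 := (sum_eq_zero_iff_of_nonneg fun t _ => sq_nonneg (a j t - r j)).1 hj0 t ht
    exact sub_eq_zero.1 (pow_eq_zero_iff two_ne_zero |>.1 ht0)
  · rw [mul_sum]
    refine sum_congr rfl fun j hj => ?_
    rw [sum_congr rfl fun t ht => by rw [h j hj t ht]]
    simp
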